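/- Let p ≥ 1, let G be an α-critical finite simple graph on n vertices with G ∈ W_p, and let r = α(G) ≥ 2. If n = rp, then G is isomorphic to the disjoint union of r copies of the complete graph K_p. -/

import Mathlib

open Finset
open scoped Classical

/-- `S` is an independent set of the graph `G`. -/
def IsIndep {V : Type*} (G : SimpleGraph V) (S : Finset V) : Prop :=
  ∀ ⦃x⦄, x ∈ S → ∀ ⦃y⦄, y ∈ S → x ≠ y → ¬ G.Adj x y

/-- The independence number `α(G)` of a finite graph `G`. -/
noncomputable def alpha {V : Type*} [Fintype V] (G : SimpleGraph V) : ℕ :=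
  Finset.univ.sup fun S : Finset V => if IsIndep G S then S.card else 0

/-- `S` is a maximum independent set of `G`. -/
def IsMaxIndep {V : Type*} [Fintype V] (G : SimpleGraph V) (S : Finset V) : Prop :=
  IsIndep G S ∧ S.card = alpha G

/-- `S` is a maximal (inclusion-wise) independent set of `G`. -/
def IsMaximalIndep {V : Type*} [DecidableEq V] (G : SimpleGraph V) (S : Finset V) : Prop :=
  IsIndep G S ∧ ∀ x, x ∉ S → ¬ IsIndep G (insert x S)

/-- `G` is well-covered: every maximal independent set has cardinality `α(G)`. -/
def WellCovered {V : Type*} [Fintype V] [DecidableEq V] (G : SimpleGraph V) : Prop :=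
  ∀ S : Finset V, IsMaximalIndep G S → S.card = alpha G

/-- `G ∈ W_p`: `|V(G)| ≥ p` and every `p` pairwise disjoint independent sets extend to
`p` pairwise disjoint maximum independent sets. -/
def MemW {V : Type*} [Fintype V] (G : SimpleGraph V) (p : ℕ) : Prop :=
  p ≤ Fintype.card V ∧
    ∀ A : Fin p → Finset V, (∀ i, IsIndep G (A i)) →
      (∀ i j, i ≠ j → Disjoint (A i) (A j)) →
      ∃ M : Fin p → Finset V, (∀ i, IsMaxIndep G (M i)) ∧
        (∀ i j, i ≠ j → Disjoint (M i) (M j)) ∧ ∀ i, A i ⊆ M i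

/-- The `W`-index of `G`: the largest `p` with `G ∈ W_p`. -/
noncomputable def wIndex {V : Type*} [Fintype V] (G : SimpleGraph V) : ℕ :=
  sSup {p : ℕ | MemW G p}

/-- The fiber `F_G(S)`: the vertices `x ∉ S` with `S ∪ {x}` a maximum independent set. -/
noncomputable def fiber {V : Type*} [Fintype V] [DecidableEq V]
    (G : SimpleGraph V) (S : Finset V) : Finset V :=
  Finset.univ.filter fun x => x ∉ S ∧ IsMaxIndep G (insert x S)

/-- `G` is `α`-critical: deleting any edge increases the independence number. -/
def AlphaCritical {V : Type*} [Fintype V] (G : SimpleGraph V) : Prop :=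
  ∀ x y, G.Adj x y → alpha G < alpha (G.deleteEdges {s(x, y)})

/-- `H` is `K_t`-saturated: `H` is `K_t`-free but adding any missing edge creates a `K_t`. -/
def KSaturated {V : Type*} [Fintype V] (H : SimpleGraph V) (t : ℕ) : Prop :=
  (∀ Q : Finset V, ¬ H.IsNClique t Q) ∧
    ∀ x y : V, x ≠ y → ¬ H.Adj x y →
      ∃ Q : Finset V, (H ⊔ SimpleGraph.fromEdgeSet {s(x, y)}).IsNClique t Q

/-- `Q` is an inclusion-maximal clique of `H`. -/
def IsMaximalClique {V : Type*} [DecidableEq V] (H : SimpleGraph V) (Q : Finset V) : Prop :=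
  H.IsClique (Q : Set V) ∧ ∀ x, x ∉ Q → ¬ H.IsClique ((insert x Q : Finset V) : Set V)

/-- The `(r-1)`-clique-codegree of `Q` in `H`: the number of vertices extending `Q`
to an `r`-clique of `H`. -/
noncomputable def codeg {V : Type*} [Fintype V] [DecidableEq V]
    (H : SimpleGraph V) (r : ℕ) (Q : Finset V) : ℕ :=
  (Finset.univ.filter fun x => x ∉ Q ∧ H.IsNClique r (insert x Q)).card

/-- The minimum `(r-1)`-clique-codegree `δ^cl_{r-1}(H)`. -/
noncomputable def minCliqueCodeg {V : Type*} [Fintype V] [DecidableEq V]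
    (H : SimpleGraph V) (r : ℕ) : ℕ :=
  sInf {m : ℕ | ∃ Q : Finset V, H.IsNClique (r - 1) Q ∧ codeg H r Q = m}

/-- The vertex set of the localization `G_S = G - N_G[S]`. -/
noncomputable def localVerts {V : Type*} [Fintype V] (G : SimpleGraph V) (S : Finset V) :
    Finset V :=
  Finset.univ.filter fun v => v ∉ S ∧ ∀ s ∈ S, ¬ G.Adj s v

/-- The localization `G_S = G - N_G[S]`, as an induced subgraph. -/
noncomputable def localize {V : Type*} [Fintype V] (G : SimpleGraph V) (S : Finset V) :
    SimpleGraph {v : V // v ∈ localVerts G S} :=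
  SimpleGraph.comap (fun v => (v : V)) G

/-- The vertex set of the edge-localization `G_{ab} = G - (N_G(a) ∪ N_G(b))`. -/
noncomputable def edgeVerts {V : Type*} [Fintype V] (G : SimpleGraph V) (a b : V) : Finset V :=
  Finset.univ.filter fun v => ¬ G.Adj a v ∧ ¬ G.Adj b v

/-- The edge-localization `G_{ab} = G - (N_G(a) ∪ N_G(b))`, as an induced subgraph. -/
noncomputable def edgeLocalize {V : Type*} [Fintype V] (G : SimpleGraph V) (a b : V) :
    SimpleGraph {v : V // v ∈ edgeVerts G a b} :=
  SimpleGraph.comap (fun v => (v : V)) G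

theorem IsIndep.mono {V : Type*} {G : SimpleGraph V} {S T : Finset V} (hT : IsIndep G T)
    (h : S ⊆ T) : IsIndep G S :=
  fun _ hx _ hy => hT (h hx) (h hy)

theorem IsIndep.card_le_alpha {V : Type*} [Fintype V] {G : SimpleGraph V} {S : Finset V}
    (hS : IsIndep G S) : S.card ≤ alpha G := by
  have h := Finset.le_sup (f := fun S : Finset V => if IsIndep G S then S.card else 0)
    (Finset.mem_univ S)
  rw [if_pos hS] at h
  exact h

/-- Every vertex is equal or adjacent to some vertex of a given maximum independent set. -/
theorem IsMaxIndep.exists_eq_or_adj {V : Type*} [Fintype V] {G : SimpleGraph V} {I : Finset V}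
    (hI : IsMaxIndep G I) (v : V) : ∃ u ∈ I, v = u ∨ G.Adj v u := by
  by_contra! h
  have hv : v ∉ I := fun hv => (h v hv).1 rfl
  have hind : IsIndep G (insert v I) := by
    intro x hx y hy hxy
    rcases Finset.mem_insert.1 hx with rfl | hx <;> rcases Finset.mem_insert.1 hy with rfl | hy
    · exact absurd rfl hxy
    · exact (h y hy).2
    · exact fun hadj => (h x ‹x ∈ I›).2 hadj.symm
    · exact hI.1 hx hy hxy
  have hcard := hind.card_le_alpha
  rw [Finset.card_insert_of_notMem hv, hI.2] at hcard
  omega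

/-- In a graph of `W_p`, every independent set of size `α - 1` has at least `p` extensions
to a maximum independent set. -/
theorem MemW.le_card_fiber {V : Type*} [Fintype V] [DecidableEq V] {G : SimpleGraph V} {p : ℕ}
    (hW : MemW G p) {S : Finset V} (hS : IsIndep G S) (hcard : S.card + 1 = alpha G) :
    p ≤ (fiber G S).card := by
  by_contra! hlt
  obtain ⟨k, rfl⟩ : ∃ k, p = k + 1 := ⟨p - 1, by omega⟩
  obtain ⟨f, hf⟩ : ∃ f : fiber G S → Fin k, Function.Injective f := by
    have : Fintype.card (fiber G S) ≤ Fintype.card (Fin k) := by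
      rw [Fintype.card_coe, Fintype.card_fin]; omega
    obtain ⟨e⟩ := Function.Embedding.nonempty_of_card_le this
    exact ⟨e, e.injective⟩
  let B : Fin k → Finset V := fun j => ((fiber G S).attach.filter fun x => f x = j).image (↑)
  have memB : ∀ j x, x ∈ B j ↔ ∃ h : x ∈ fiber G S, f ⟨x, h⟩ = j := by
    intro j x
    simp [B]
  have hBS : ∀ j, Disjoint S (B j) := by
    intro j
    refine Finset.disjoint_left.2 fun x hxS hx => ?_
    obtain ⟨h, -⟩ := (memB j x).1 hx
    exact (Finset.mem_filter.1 h).2.1 hxS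
  obtain ⟨M, hM, hdisj, hsub⟩ := hW.2 (Fin.cons S B)
    (by
      intro i
      refine Fin.cases hS (fun j => ?_) i
      intro x hx y hy hxy
      obtain ⟨h, hx⟩ := (memB j x).1 hx
      obtain ⟨h', hy⟩ := (memB j y).1 hy
      exact absurd (congrArg Subtype.val (hf (hx.trans hy.symm))) hxy)
    (by
      intro i j
      refine Fin.cases ?_ (fun i => ?_) i <;> refine Fin.cases ?_ (fun j => ?_) j
      · exact fun h => absurd rfl h
      · exact fun _ => hBS j
      · exact fun _ => (hBS i).symm
      · intro hij
        refine Finset.disjoint_left.2 fun x hx hx' => hij ?_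
        obtain ⟨h, hx⟩ := (memB i x).1 hx
        obtain ⟨h', hx'⟩ := (memB j x).1 hx'
        rw [← hx, ← hx'])
  have hS0 : S ⊆ M 0 := hsub 0
  obtain ⟨x, hx, hxS⟩ := Finset.exists_mem_notMem_of_card_lt_card
    (show S.card < (M 0).card by rw [(hM 0).2]; omega)
  have hins : insert x S ⊆ M 0 := Finset.insert_subset hx hS0
  have hxF : x ∈ fiber G S := by
    refine Finset.mem_filter.2 ⟨Finset.mem_univ x, hxS, (hM 0).1.mono hins, ?_⟩
    rw [Finset.card_insert_of_notMem hxS, hcard]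
  have hxM : x ∈ M (f ⟨x, hxF⟩).succ := hsub (f ⟨x, hxF⟩).succ ((memB _ x).2 ⟨hxF, rfl⟩)
  exact Finset.disjoint_left.1 (hdisj 0 _ (Fin.succ_ne_zero _).symm) hx hxM

/-- If a graph of `W_p` has `α p` vertices, then no vertex has two neighbours in a common
maximum independent set. -/
theorem MemW.eq_of_adj_of_adj {V : Type*} [Fintype V] [DecidableEq V] {G : SimpleGraph V} {p : ℕ}
    (hW : MemW G p) (hn : Fintype.card V ≤ alpha G * p) {I : Finset V} (hI : IsMaxIndep G I)
    {x y z : V} (hx : x ∈ I) (hz : z ∈ I) (hxy : G.Adj y x) (hyz : G.Adj y z) : x = z := by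
  by_contra hxz
  have hdisj : (I : Set V).PairwiseDisjoint fun v => fiber G (I.erase v) := by
    intro v hv w hw hvw
    refine Finset.disjoint_left.2 fun u hu hu' => ?_
    obtain ⟨-, hu, huI⟩ := Finset.mem_filter.1 hu
    obtain ⟨-, hu', huI'⟩ := Finset.mem_filter.1 hu'
    have huI_not : u ∉ I := by
      intro h
      have h₁ : u = v := by simpa [h] using hu
      have h₂ : u = w := by simpa [h] using hu'
      exact hvw (h₁.symm.trans h₂)
    obtain ⟨t, ht, hut⟩ := hI.exists_eq_or_adj u
    have hne : u ≠ t := fun h => huI_not (h ▸ ht)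
    have hadj := hut.resolve_left hne
    by_cases htv : t = v
    · exact huI'.1 (Finset.mem_insert_self _ _)
        (Finset.mem_insert_of_mem (Finset.mem_erase.2 ⟨fun h => hvw (htv.symm.trans h), ht⟩))
        hne hadj
    · exact huI.1 (Finset.mem_insert_self _ _)
        (Finset.mem_insert_of_mem (Finset.mem_erase.2 ⟨htv, ht⟩)) hne hadj
  have hy : y ∉ I.biUnion fun v => fiber G (I.erase v) := by
    intro h
    obtain ⟨v, -, h⟩ := Finset.mem_biUnion.1 h
    have hind := (Finset.mem_filter.1 h).2.2.1
    have hv : ∀ w ∈ I, G.Adj y w → w = v := fun w hw hadj => by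
      by_contra hwv
      exact hind (Finset.mem_insert_self _ _)
        (Finset.mem_insert_of_mem (Finset.mem_erase.2 ⟨hwv, hw⟩)) hadj.ne hadj
    exact hxz ((hv x hx hxy).trans (hv z hz hyz).symm)
  have hlt := Finset.card_lt_univ_of_notMem hy
  rw [Finset.card_biUnion hdisj] at hlt
  have hle : I.card * p ≤ ∑ v ∈ I, (fiber G (I.erase v)).card := by
    rw [← smul_eq_mul]
    refine Finset.card_nsmul_le_sum _ _ _ fun v hv => ?_
    exact hW.le_card_fiber (hI.1.mono (Finset.erase_subset _ _))
      (by rw [Finset.card_erase_add_one hv, hI.2])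
  rw [hI.2] at hle
  omega

/-- In a graph of `W_p`, `p ≥ 1`, with `α p` vertices, adjacency is transitive on distinct
vertices. -/
theorem MemW.adj_trans {V : Type*} [Fintype V] [DecidableEq V] {G : SimpleGraph V} {p : ℕ}
    (hp : 1 ≤ p) (hW : MemW G p) (hn : Fintype.card V ≤ alpha G * p) {x y z : V}
    (hxy : G.Adj x y) (hyz : G.Adj y z) (hxz : x ≠ z) : G.Adj x z := by
  by_contra hnadj
  let i₀ : Fin p := ⟨0, hp⟩
  obtain ⟨M, hM, -, hsub⟩ := hW.2 (fun i => if i = i₀ then {x, z} else ∅)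
    (by
      intro i
      split_ifs
      · intro a ha b hb hab
        simp only [Finset.mem_insert, Finset.mem_singleton] at ha hb
        rcases ha with rfl | rfl <;> rcases hb with rfl | rfl
        · exact absurd rfl hab
        · exact hnadj
        · exact fun h => hnadj h.symm
        · exact absurd rfl hab
      · intro a ha
        exact absurd ha (Finset.notMem_empty a))
    (by
      intro i j hij
      split_ifs with h₁ h₂
      · exact absurd (h₁.trans h₂.symm) hij
      all_goals simp)
  have hsub₀ : {x, z} ⊆ M i₀ := by simpa using hsub i₀
  exact hxz (hW.eq_of_adj_of_adj hn (hM i₀) (hsub₀ (by simp)) (hsub₀ (by simp)) hxy.symm hyz)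

/-- The case `n = rp`: `G` is a disjoint union of `r` copies of `K_p`. -/
theorem order_rp_rigidity {V : Type*} [Fintype V] [DecidableEq V]
    (G : SimpleGraph V) (p r : ℕ) (hp : 1 ≤ p)
    (hcrit : AlphaCritical G) (hW : MemW G p) (hr : 2 ≤ r) (halpha : alpha G = r)
    (hn : Fintype.card V = r * p) :
    Nonempty (G ≃g SimpleGraph.fromRel fun x y : Fin r × Fin p => x.1 = y.1) := by
  subst halpha
  obtain ⟨M, hM, hdisj, -⟩ := hW.2 (fun _ => ∅)
    (fun _ a ha => absurd ha (Finset.notMem_empty a)) (fun _ _ _ => Finset.disjoint_empty_left _)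
  have hcover : ∀ v, ∃ i, v ∈ M i := by
    have hcard : (Finset.univ.biUnion M).card = Fintype.card V := by
      rw [Finset.card_biUnion fun i _ j _ hij => hdisj i j hij,
        Finset.sum_congr rfl fun i _ => (hM i).2]
      simp [hn, mul_comm]
    intro v
    have hv : v ∈ Finset.univ.biUnion M := by
      rw [Finset.card_eq_iff_eq_univ _ |>.1 hcard]
      exact Finset.mem_univ v
    simpa using hv
  choose c hc using hcover
  let I := M ⟨0, hp⟩
  have hI : IsMaxIndep G I := hM _
  choose f hfI hf using hI.exists_eq_or_adj
  have hadj : ∀ {u v}, u ≠ v → (G.Adj u v ↔ f u = f v) := by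
    intro u v huv
    constructor
    · intro h
      have hv : u = f v ∨ G.Adj u (f v) := by
        rcases hf v with hv | hv
        · exact Or.inr (hv ▸ h)
        · exact or_iff_not_imp_left.2 (hW.adj_trans hp hn.le h hv)
      by_contra hne
      rcases hf u with hu | hu <;> rcases hv with hv | hv
      · exact hne (hu.symm.trans hv)
      · exact hI.1 (hfI u) (hfI v) hne (hu ▸ hv)
      · exact hI.1 (hfI u) (hfI v) hne (by rw [← hv]; exact hu.symm)
      · exact hne (hW.eq_of_adj_of_adj hn.le hI (hfI u) (hfI v) hu hv)
    · intro h
      rcases hf u with hu | hu <;> rcases hf v with hv | hv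
      · exact absurd (hu.trans (h.trans hv.symm)) huv
      · exact (hu.trans h) ▸ hv.symm
      · exact (hv.trans h.symm) ▸ hu
      · exact hW.adj_trans hp hn.le hu (h ▸ hv.symm) huv
  let e : I ≃ Fin (alpha G) := Fintype.equivFinOfCardEq (by rw [Fintype.card_coe, hI.2])
  let F : V → Fin (alpha G) × Fin p := fun v => (e ⟨f v, hfI v⟩, c v)
  have hF₁ : ∀ u v, (F u).1 = (F v).1 ↔ f u = f v := by
    intro u v
    simp [F]
  have hF : Function.Injective F := by
    intro u v huv
    by_contra hne
    have hcuv : c u = c v := congrArg Prod.snd huv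
    exact (hM (c u)).1 (hc u) (hcuv ▸ hc v) hne
      ((hadj hne).2 ((hF₁ u v).1 (congrArg Prod.fst huv)))
  have hbij : Function.Bijective F :=
    (Fintype.bijective_iff_injective_and_card F).2 ⟨hF, by simp [hn]⟩
  refine ⟨⟨Equiv.ofBijective F hbij, ?_⟩⟩
  intro u v
  rw [Equiv.ofBijective_apply, Equiv.ofBijective_apply, SimpleGraph.fromRel_adj,
    eq_comm (a := (F v).1), or_self, hF₁]
  by_cases huv : u = v
  · simp [huv]
  · rw [hadj huv]
    exact and_iff_right (hF.ne huv)
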